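/- Isothermal coordinates are conformal harmonic (Proposition 2.9, coordinate version): Let n ≥ 3, k ∈ ℕ with k ≥ 2, and α ∈ (0,1). Let c be a positive function of class C^{k+α} on an open set U ⊆ ℝⁿ and let g be the isothermal metric g(x) = c(x)·Id on U. Then, with f := c^{(2−n)/4}, one has L_g f = 0 on U and L_g(x^k f) = 0 on U for every k = 1, …, n; consequently x^k = (x^k f)/f for every k, so the identity coordinates on U are conformal harmonic for g (each coordinate function is a quotient of solutions of L_g u = 0 with positive denominator). -/

import Mathlib

noncomputable section

open Set Matrix Matrix

/-- Points of `ℝⁿ`. -/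
abbrev Pt (n : ℕ) := Fin n → ℝ

/-- A metric in coordinates: a matrix-valued map. -/
abbrev Met (n : ℕ) := Pt n → Matrix (Fin n) (Fin n) ℝ

/-- Partial derivative of `f` in the `a`-th coordinate direction. -/
def pd {n : ℕ} (a : Fin n) (f : Pt n → ℝ) (x : Pt n) : ℝ :=
  fderiv ℝ f x (Pi.single a 1)

/-- `g` is a metric (pointwise symmetric positive definite) on `U`. -/
def IsMetricOn {n : ℕ} (g : Met n) (U : Set (Pt n)) : Prop :=
  ∀ x ∈ U, (g x).IsSymm ∧ (g x).PosDef

/-- Christoffel symbols `Γ^c_{ab}` of `g`. -/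
def christoffel {n : ℕ} (g : Met n) (c a b : Fin n) (x : Pt n) : ℝ :=
  (1 / 2) * ∑ d, (g x)⁻¹ c d *
    (pd a (fun y => g y b d) x + pd b (fun y => g y a d) x - pd d (fun y => g y a b) x)

/-- Ricci tensor `R_{ab}` of `g`. -/
def ricci {n : ℕ} (g : Met n) (a b : Fin n) (x : Pt n) : ℝ :=
  (∑ c, pd c (christoffel g c a b) x) - (∑ c, pd a (christoffel g c c b) x)
    + (∑ c, ∑ d, christoffel g c a b x * christoffel g d d c x)
    - (∑ c, ∑ d, christoffel g d c b x * christoffel g c a d x)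

/-- Scalar curvature `R(g)`. -/
def scalarCurv {n : ℕ} (g : Met n) (x : Pt n) : ℝ :=
  ∑ a, ∑ b, (g x)⁻¹ a b * ricci g a b x

/-- Laplace–Beltrami operator `Δ_g`. -/
def laplaceBeltrami {n : ℕ} (g : Met n) (u : Pt n → ℝ) (x : Pt n) : ℝ :=
  -(Real.sqrt (g x).det)⁻¹ *
    ∑ a, pd a (fun y => Real.sqrt (g y).det * ∑ b, (g y)⁻¹ a b * pd b u y) x

/-- Conformal Laplacian `L_g`. -/
def confLap {n : ℕ} (g : Met n) (u : Pt n → ℝ) (x : Pt n) : ℝ :=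
  laplaceBeltrami g u x + (((n : ℝ) - 2) / (4 * ((n : ℝ) - 1))) * scalarCurv g x * u x

/-- `f` is of class `C^{k+α}` on `s`: it is `C^k` there and its `k`-th order derivatives are
locally `α`-Hölder continuous. -/
def CHolderOn {n : ℕ} (k : ℕ) (α : ℝ) (s : Set (Pt n)) (f : Pt n → ℝ) : Prop :=
  ContDiffOn ℝ k f s ∧
    ∀ x ∈ s, ∃ C : NNReal, ∃ t ∈ nhdsWithin x s,
      HolderOnWith C (Real.toNNReal α) (iteratedFDerivWithin ℝ k f s) t

/-- All entries of `g` are of class `C^{k+α}` on `s`. -/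
def MetCHolderOn {n : ℕ} (k : ℕ) (α : ℝ) (s : Set (Pt n)) (g : Met n) : Prop :=
  ∀ a b, CHolderOn k α s fun x => g x a b

/-- Contracted Christoffel symbol `Γ^a = g^{bc} Γ^a_{bc}`. -/
def gammaUp {n : ℕ} (g : Met n) (a : Fin n) (x : Pt n) : ℝ :=
  ∑ b, ∑ c, (g x)⁻¹ b c * christoffel g a b c x

/-- Contracted Christoffel symbol `Γ_a = g_{ab} Γ^b`. -/
def gammaLow {n : ℕ} (g : Met n) (a : Fin n) (x : Pt n) : ℝ :=
  ∑ b, g x a b * gammaUp g b x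

/-- `g` satisfies the conformal harmonic gauge on `U`. -/
def ConfHarmonicGauge {n : ℕ} (g : Met n) (U : Set (Pt n)) : Prop :=
  ∃ f : Pt n → ℝ, ContDiffOn ℝ 2 f U ∧ (∀ x ∈ U, 0 < f x) ∧
    (∀ x ∈ U, confLap g f x = 0) ∧
    ∀ a : Fin n, ∀ x ∈ U, gammaLow g a x = 2 * pd a (fun y => Real.log (f y)) x

/-- Determinant-normalized metric `ĝ = (det g)^{-1/n} g`. -/
def dnorm {n : ℕ} (g : Met n) : Met n :=
  fun x => ((g x).det ^ (-(1 : ℝ) / (n : ℝ))) • g x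

/-- Jacobian matrix of a map `Z : ℝⁿ → ℝⁿ`. -/
def jac {n : ℕ} (Z : Pt n → Pt n) (x : Pt n) : Matrix (Fin n) (Fin n) ℝ :=
  Matrix.of fun i j => pd j (fun y => Z y i) x

/-- Riemann curvature tensor `R_{abc}{}^{d}`. -/
def riemannUp {n : ℕ} (g : Met n) (a b c d : Fin n) (x : Pt n) : ℝ :=
  pd a (christoffel g d b c) x - pd b (christoffel g d a c) x
    + (∑ e, christoffel g e b c x * christoffel g d a e x)
    - (∑ e, christoffel g e a c x * christoffel g d b e x)

/-- Riemann curvature tensor `R_{abcd} = R_{abc}{}^{e} g_{ed}`. -/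
def riemannLow {n : ℕ} (g : Met n) (a b c d : Fin n) (x : Pt n) : ℝ :=
  ∑ e, riemannUp g a b c e x * g x e d

/-- Schouten tensor `P_{ab}`. -/
def schouten {n : ℕ} (g : Met n) (a b : Fin n) (x : Pt n) : ℝ :=
  (1 / ((n : ℝ) - 2)) * (ricci g a b x - (scalarCurv g x / (2 * ((n : ℝ) - 1))) * g x a b)

/-- Weyl tensor `W_{abcd}`. -/
def weyl {n : ℕ} (g : Met n) (a b c d : Fin n) (x : Pt n) : ℝ :=
  riemannLow g a b c d x + schouten g a c x * g x b d - schouten g b c x * g x a d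
    + schouten g b d x * g x a c - schouten g a d x * g x b c

/-- Weyl tensor with raised last index, `W_{abc}{}^{d} = g^{de} W_{abce}`. -/
def weylUp {n : ℕ} (g : Met n) (a b c d : Fin n) (x : Pt n) : ℝ :=
  ∑ e, (g x)⁻¹ d e * weyl g a b c e x

/-- Covariant derivative of a 2-tensor: `(∇T)_{cab} = ∇_c T_{ab}`. -/
def cov2 {n : ℕ} (g : Met n) (T : Fin n → Fin n → Pt n → ℝ) (c a b : Fin n) (x : Pt n) : ℝ :=
  pd c (T a b) x - (∑ d, christoffel g d c a x * T d b x)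
    - ∑ d, christoffel g d c b x * T a d x

/-- Covariant derivative of a 3-tensor: `(∇T)_{dabc} = ∇_d T_{abc}`. -/
def cov3 {n : ℕ} (g : Met n) (T : Fin n → Fin n → Fin n → Pt n → ℝ) (d a b c : Fin n)
    (x : Pt n) : ℝ :=
  pd d (T a b c) x - (∑ e, christoffel g e d a x * T e b c x)
    - (∑ e, christoffel g e d b x * T a e c x)
    - ∑ e, christoffel g e d c x * T a b e x

/-- Cotton tensor `C_{abc} = ∇_a P_{bc} - ∇_b P_{ac}`. -/
def cotton {n : ℕ} (g : Met n) (a b c : Fin n) (x : Pt n) : ℝ :=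
  cov2 g (schouten g) a b c x - cov2 g (schouten g) b a c x

/-- Bach tensor `B_{ab}`. -/
def bach {n : ℕ} (g : Met n) (a b : Fin n) (x : Pt n) : ℝ :=
  (∑ c, ∑ d, (g x)⁻¹ c d *
      (cov3 g (cov2 g (schouten g)) d a b c x - cov3 g (cov2 g (schouten g)) d c a b x))
    + ∑ c, ∑ d, ∑ e, ∑ f, (g x)⁻¹ c e * (g x)⁻¹ d f * schouten g e f x * weyl g a c d b x

open scoped Topology

section PartialDerivative

variable {n : ℕ} {a : Fin n} {f h : Pt n → ℝ} {x : Pt n}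

lemma pd_congr (e : f =ᶠ[𝓝 x] h) : pd a f x = pd a h x := by
  simp only [pd, e.fderiv_eq]

lemma pd_const (r : ℝ) : pd a (fun _ => r) x = 0 := by
  simp [pd]

lemma pd_const_mul (r : ℝ) (hf : DifferentiableAt ℝ f x) :
    pd a (fun y => r * f y) x = r * pd a f x := by
  simp [pd, (hf.hasFDerivAt.const_mul r).fderiv]

lemma pd_mul (hf : DifferentiableAt ℝ f x) (hh : DifferentiableAt ℝ h x) :
    pd a (fun y => f y * h y) x = f x * pd a h x + h x * pd a f x := by
  simp [pd, (hf.hasFDerivAt.fun_mul hh.hasFDerivAt).fderiv]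

lemma pd_add (hf : DifferentiableAt ℝ f x) (hh : DifferentiableAt ℝ h x) :
    pd a (fun y => f y + h y) x = pd a f x + pd a h x := by
  simp [pd, (hf.hasFDerivAt.fun_add hh.hasFDerivAt).fderiv]

lemma pd_sub (hf : DifferentiableAt ℝ f x) (hh : DifferentiableAt ℝ h x) :
    pd a (fun y => f y - h y) x = pd a f x - pd a h x := by
  simp [pd, (hf.hasFDerivAt.fun_sub hh.hasFDerivAt).fderiv]

lemma pd_exp (hf : DifferentiableAt ℝ f x) :
    pd a (fun y => Real.exp (f y)) x = Real.exp (f x) * pd a f x := by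
  simp [pd, hf.hasFDerivAt.exp.fderiv]

lemma pd_coord (i : Fin n) :
    pd a (fun y : Pt n => y i) x = (1 : Matrix (Fin n) (Fin n) ℝ) i a := by
  have : HasFDerivAt (fun y : Pt n => y i) (ContinuousLinearMap.proj i : Pt n →L[ℝ] ℝ) x :=
    hasFDerivAt_apply i x
  simp [pd, this.fderiv, Matrix.one_apply, Pi.single_apply]

lemma differentiableAt_pd {U : Set (Pt n)} (hU : IsOpen U) (hf : ContDiffOn ℝ 2 f U)
    (hx : x ∈ U) : DifferentiableAt ℝ (pd a f) x := by
  have h1 : ContDiffOn ℝ 1 (fderiv ℝ f) U := hf.fderiv_of_isOpen hU (by norm_num)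
  have h2 : DifferentiableAt ℝ (fderiv ℝ f) x :=
    (h1.differentiableOn (by norm_num)).differentiableAt (hU.mem_nhds hx)
  exact h2.clm_apply (differentiableAt_const _)

end PartialDerivative

section ConformallyFlat

variable {n : ℕ} {U : Set (Pt n)} {φ : Pt n → ℝ} {g : Met n}

lemma inv_exp_smul_one (t : ℝ) :
    (Real.exp t • (1 : Matrix (Fin n) (Fin n) ℝ))⁻¹ = Real.exp (-t) • 1 := by
  apply Matrix.inv_eq_right_inv
  simp [smul_smul, ← Real.exp_add]

lemma sqrt_det_exp_smul_one (t : ℝ) :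
    Real.sqrt (Real.exp t • (1 : Matrix (Fin n) (Fin n) ℝ)).det = Real.exp (n * t / 2) := by
  rw [Matrix.det_smul, Matrix.det_one, mul_one, Fintype.card_fin, ← Real.exp_nat_mul,
    ← Real.exp_half]

lemma christoffel_conformallyFlat (hU : IsOpen U) (hφ : ContDiffOn ℝ 2 φ U)
    (hg : ∀ x ∈ U, g x = Real.exp (φ x) • (1 : Matrix (Fin n) (Fin n) ℝ))
    {x : Pt n} (hx : x ∈ U) (k a b : Fin n) :
    christoffel g k a b x = (1 / 2) * ((1 : Matrix (Fin n) (Fin n) ℝ) k b * pd a φ x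
      + (1 : Matrix (Fin n) (Fin n) ℝ) k a * pd b φ x
      - (1 : Matrix (Fin n) (Fin n) ℝ) a b * pd k φ x) := by
  have hd : DifferentiableAt ℝ φ x :=
    (hφ.differentiableOn (by norm_num)).differentiableAt (hU.mem_nhds hx)
  have key (i j l : Fin n) : pd i (fun y => g y j l) x
      = (1 : Matrix (Fin n) (Fin n) ℝ) j l * (Real.exp (φ x) * pd i φ x) := by
    rw [← pd_exp hd, ← pd_const_mul _ hd.exp]
    apply pd_congr
    filter_upwards [hU.mem_nhds hx] with y hy
    rw [hg y hy, Matrix.smul_apply, smul_eq_mul, mul_comm]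
  have one_comm (i j : Fin n) : (1 : Matrix (Fin n) (Fin n) ℝ) i j
      = (1 : Matrix (Fin n) (Fin n) ℝ) j i := by
    simp only [Matrix.one_apply, eq_comm]
  have he : Real.exp (-φ x) * Real.exp (φ x) = 1 := by simp [← Real.exp_add]
  simp only [christoffel, key, hg x hx, inv_exp_smul_one, Matrix.smul_apply, smul_eq_mul]
  rw [Finset.sum_eq_single k]
  · rw [Matrix.one_apply_eq, one_comm b k, one_comm a k]
    linear_combination (1 / 2) * ((1 : Matrix (Fin n) (Fin n) ℝ) k b * pd a φ x
      + (1 : Matrix (Fin n) (Fin n) ℝ) k a * pd b φ x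
      - (1 : Matrix (Fin n) (Fin n) ℝ) a b * pd k φ x) * he
  · intro d _ hdk
    simp [Matrix.one_apply_ne' hdk]
  · simp

lemma pd_christoffel_conformallyFlat (hU : IsOpen U) (hφ : ContDiffOn ℝ 2 φ U)
    (hg : ∀ x ∈ U, g x = Real.exp (φ x) • (1 : Matrix (Fin n) (Fin n) ℝ))
    {x : Pt n} (hx : x ∈ U) (l k a b : Fin n) :
    pd l (christoffel g k a b) x
      = (1 / 2) * ((1 : Matrix (Fin n) (Fin n) ℝ) k b * pd l (pd a φ) x
        + (1 : Matrix (Fin n) (Fin n) ℝ) k a * pd l (pd b φ) x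
        - (1 : Matrix (Fin n) (Fin n) ℝ) a b * pd l (pd k φ) x) := by
  have hp (i : Fin n) : DifferentiableAt ℝ (pd i φ) x := differentiableAt_pd hU hφ hx
  have e : christoffel g k a b =ᶠ[𝓝 x] fun y =>
      (1 / 2) * ((1 : Matrix (Fin n) (Fin n) ℝ) k b * pd a φ y
        + (1 : Matrix (Fin n) (Fin n) ℝ) k a * pd b φ y
        - (1 : Matrix (Fin n) (Fin n) ℝ) a b * pd k φ y) := by
    filter_upwards [hU.mem_nhds hx] with y hy
    exact christoffel_conformallyFlat hU hφ hg hy k a b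
  have h1 := (hp a).const_mul ((1 : Matrix (Fin n) (Fin n) ℝ) k b)
  have h2 := (hp b).const_mul ((1 : Matrix (Fin n) (Fin n) ℝ) k a)
  have h3 := (hp k).const_mul ((1 : Matrix (Fin n) (Fin n) ℝ) a b)
  rw [pd_congr e, pd_const_mul _ ((h1.fun_add h2).fun_sub h3), pd_sub (h1.fun_add h2) h3,
    pd_add h1 h2, pd_const_mul _ (hp a), pd_const_mul _ (hp b), pd_const_mul _ (hp k)]

lemma scalarCurv_conformallyFlat (hU : IsOpen U) (hφ : ContDiffOn ℝ 2 φ U)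
    (hg : ∀ x ∈ U, g x = Real.exp (φ x) • (1 : Matrix (Fin n) (Fin n) ℝ))
    {x : Pt n} (hx : x ∈ U) :
    scalarCurv g x = -(((n : ℝ) - 1) * Real.exp (-φ x)
      * (∑ a, pd a (pd a φ) x + ((n : ℝ) - 2) / 4 * ∑ a, pd a φ x ^ 2)) := by
  have h1 : ∑ a, ∑ k, pd k (christoffel g k a a) x
      = (1 - (n : ℝ) / 2) * ∑ a, pd a (pd a φ) x := by
    simp only [pd_christoffel_conformallyFlat hU hφ hg hx, Matrix.one_apply_eq,
      ← Finset.mul_sum, Finset.sum_add_distrib, Finset.sum_sub_distrib, Matrix.one_apply,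
      ite_mul, zero_mul, one_mul, Finset.sum_ite_eq', Finset.mem_univ, if_true,
      Finset.sum_const, Finset.card_univ, Fintype.card_fin, nsmul_eq_mul]
    ring
  have h2 : ∑ a, ∑ k, pd a (christoffel g k k a) x
      = (n : ℝ) / 2 * ∑ a, pd a (pd a φ) x := by
    simp only [pd_christoffel_conformallyFlat hU hφ hg hx, Matrix.one_apply_eq,
      ← Finset.mul_sum, Finset.sum_add_distrib, Finset.sum_sub_distrib, Matrix.one_apply,
      ite_mul, zero_mul, one_mul, Finset.sum_ite_eq', Finset.mem_univ, if_true,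
      Finset.sum_const, Finset.card_univ, Fintype.card_fin, nsmul_eq_mul]
    ring
  have htr (k : Fin n) : ∑ d, christoffel g d d k x = (n : ℝ) / 2 * pd k φ x := by
    simp only [christoffel_conformallyFlat hU hφ hg hx, Matrix.one_apply_eq,
      ← Finset.mul_sum, Finset.sum_add_distrib, Finset.sum_sub_distrib, Matrix.one_apply,
      ite_mul, zero_mul, one_mul, Finset.sum_ite_eq', Finset.mem_univ, if_true,
      Finset.sum_const, Finset.card_univ, Fintype.card_fin, nsmul_eq_mul]
    ring
  have htr' (k : Fin n) : ∑ a, christoffel g k a a x = (1 - (n : ℝ) / 2) * pd k φ x := by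
    simp only [christoffel_conformallyFlat hU hφ hg hx, Matrix.one_apply_eq,
      ← Finset.mul_sum, Finset.sum_add_distrib, Finset.sum_sub_distrib, Matrix.one_apply,
      ite_mul, zero_mul, one_mul, Finset.sum_ite_eq, Finset.mem_univ, if_true,
      Finset.sum_const, Finset.card_univ, Fintype.card_fin, nsmul_eq_mul]
    ring
  have h3 : ∑ a, ∑ k, ∑ d, christoffel g k a a x * christoffel g d d k x
      = (1 - (n : ℝ) / 2) * ((n : ℝ) / 2) * ∑ a, pd a φ x ^ 2 := by
    simp only [← Finset.mul_sum, htr]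
    rw [Finset.sum_comm]
    simp only [← Finset.sum_mul, htr']
    rw [Finset.mul_sum]
    exact Finset.sum_congr rfl fun k _ => by ring
  have h4 : ∑ a, ∑ k, ∑ d, christoffel g d k a x * christoffel g k a d x
      = (2 - (n : ℝ)) / 4 * ∑ a, pd a φ x ^ 2 := by
    have hterm (a k d : Fin n) : christoffel g d k a x * christoffel g k a d x
        = (1 / 4) * ((if d = k then pd a φ x ^ 2 else 0) - (if d = a then pd k φ x ^ 2 else 0)
          - (if k = a then pd d φ x ^ 2 else 0)
          + 2 * (if d = a then if k = a then pd a φ x ^ 2 else 0 else 0)) := by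
      simp only [christoffel_conformallyFlat hU hφ hg hx, Matrix.one_apply]
      by_cases h1 : d = k
      · subst h1
        by_cases h2 : d = a
        · subst h2
          simp only [if_true]
          ring
        · simp only [if_true, if_neg h2, if_neg (Ne.symm h2)]
          ring
      · by_cases h2 : d = a
        · subst h2
          simp only [if_true, if_neg h1, if_neg (Ne.symm h1)]
          ring
        · by_cases h3 : k = a
          · subst h3
            simp only [if_true, if_neg h1, if_neg (Ne.symm h1)]
            ring
          · simp only [if_neg h1, if_neg h2, if_neg h3]
            ring
    simp only [hterm, ← Finset.mul_sum, Finset.sum_add_distrib, Finset.sum_sub_distrib,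
      Finset.sum_ite_irrel, Finset.sum_const_zero, Finset.sum_ite_eq',
      Finset.mem_univ, if_true, Finset.sum_const, Finset.card_univ, Fintype.card_fin, nsmul_eq_mul]
    ring
  have hR : scalarCurv g x = Real.exp (-φ x) * ∑ a, ricci g a a x := by
    simp only [scalarCurv, hg x hx, inv_exp_smul_one, Matrix.smul_apply, Matrix.one_apply,
      smul_eq_mul, mul_ite, mul_one, mul_zero, ite_mul, zero_mul, Finset.sum_ite_eq,
      Finset.mem_univ, if_true, Finset.mul_sum]
  rw [hR]
  simp only [ricci, Finset.sum_add_distrib, Finset.sum_sub_distrib]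
  rw [h1, h2, h3, h4]
  ring

/-- The Laplace–Beltrami operator of `exp φ • 1` applied to `ψ * exp (s * φ)`, where
`s = (2 - n) / 4` and `ψ` is affine with gradient `q`. -/
lemma laplaceBeltrami_conformallyFlat (hU : IsOpen U) (hφ : ContDiffOn ℝ 2 φ U)
    (hg : ∀ x ∈ U, g x = Real.exp (φ x) • (1 : Matrix (Fin n) (Fin n) ℝ))
    {ψ u : Pt n → ℝ} {q : Fin n → ℝ} (hψ : Differentiable ℝ ψ) (hq : ∀ a x, pd a ψ x = q a)
    {s : ℝ} (hs : s = (2 - (n : ℝ)) / 4) (hu : ∀ x ∈ U, u x = ψ x * Real.exp (s * φ x))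
    {x : Pt n} (hx : x ∈ U) :
    laplaceBeltrami g u x = -(s * Real.exp (-φ x) * u x
      * (∑ a, pd a (pd a φ) x - s * ∑ a, pd a φ x ^ 2)) := by
  have hd {y : Pt n} (hy : y ∈ U) : DifferentiableAt ℝ φ y :=
    (hφ.differentiableOn (by norm_num)).differentiableAt (hU.mem_nhds hy)
  have hdu {y : Pt n} (hy : y ∈ U) (a : Fin n) :
      pd a u y = Real.exp (s * φ y) * (q a + s * (ψ y * pd a φ y)) := by
    have e : u =ᶠ[𝓝 y] fun z => ψ z * Real.exp (s * φ z) := by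
      filter_upwards [hU.mem_nhds hy] with z hz using hu z hz
    rw [pd_congr e, pd_mul (hψ y) ((hd hy).const_mul s).exp, pd_exp ((hd hy).const_mul s),
      pd_const_mul s (hd hy), hq]
    ring
  have hflux (a : Fin n) :
      pd a (fun y => Real.sqrt (g y).det * ∑ b, (g y)⁻¹ a b * pd b u y) x
        = Real.exp (-s * φ x) * (s * (ψ x * (pd a (pd a φ) x - s * pd a φ x ^ 2))) := by
    have hp : DifferentiableAt ℝ (pd a φ) x := differentiableAt_pd hU hφ hx
    have e : (fun y => Real.sqrt (g y).det * ∑ b, (g y)⁻¹ a b * pd b u y) =ᶠ[𝓝 x]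
        fun y => Real.exp (-s * φ y) * (q a + s * (ψ y * pd a φ y)) := by
      filter_upwards [hU.mem_nhds hx] with y hy
      simp only [hg y hy, inv_exp_smul_one, sqrt_det_exp_smul_one, Matrix.smul_apply,
        Matrix.one_apply, smul_eq_mul, mul_ite, mul_one, mul_zero, ite_mul, zero_mul,
        Finset.sum_ite_eq, Finset.mem_univ, if_true]
      rw [hdu hy, ← mul_assoc, ← mul_assoc, ← Real.exp_add, ← Real.exp_add]
      congr 2
      rw [hs]
      ring
    have hE := (hd hx).const_mul (-s)
    have hψp := (hψ x).fun_mul hp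
    rw [pd_congr e, pd_mul hE.exp ((differentiableAt_const _).fun_add (hψp.const_mul s)),
      pd_exp hE, pd_const_mul _ (hd hx), pd_add (differentiableAt_const _) (hψp.const_mul s),
      pd_const, pd_const_mul s hψp, pd_mul (hψ x) hp, hq]
    ring
  have hexp : (Real.exp (n * φ x / 2))⁻¹ * Real.exp (-s * φ x)
      = Real.exp (-φ x) * Real.exp (s * φ x) := by
    rw [← Real.exp_neg, ← Real.exp_add, ← Real.exp_add, hs]
    congr 1
    ring
  simp only [laplaceBeltrami, hflux, ← Finset.mul_sum, Finset.sum_sub_distrib]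
  rw [hg x hx, sqrt_det_exp_smul_one, hu x hx]
  linear_combination (-(s * (ψ x
    * (∑ a, pd a (pd a φ) x - s * ∑ a, pd a φ x ^ 2)))) * hexp

lemma confLap_conformallyFlat_eq_zero (hn : n ≠ 1) (hU : IsOpen U) (hφ : ContDiffOn ℝ 2 φ U)
    (hg : ∀ x ∈ U, g x = Real.exp (φ x) • (1 : Matrix (Fin n) (Fin n) ℝ))
    {ψ u : Pt n → ℝ} {q : Fin n → ℝ} (hψ : Differentiable ℝ ψ) (hq : ∀ a x, pd a ψ x = q a)
    (hu : ∀ x ∈ U, u x = ψ x * Real.exp ((2 - (n : ℝ)) / 4 * φ x))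
    {x : Pt n} (hx : x ∈ U) : confLap g u x = 0 := by
  have hn' : (n : ℝ) - 1 ≠ 0 := sub_ne_zero.mpr (by exact_mod_cast hn)
  rw [confLap, laplaceBeltrami_conformallyFlat hU hφ hg hψ hq rfl hu hx,
    scalarCurv_conformallyFlat hU hφ hg hx]
  field_simp
  ring

end ConformallyFlat

/-- Proposition 2.9: isothermal coordinates are conformal harmonic; for
`g = c · Id` the function `f = c^{(2-n)/4}` and the functions `x^k f` solve `L_g u = 0`. -/
theorem isothermal_coordinates_are_conformal_harmonic
    (n k : ℕ) (hn : 3 ≤ n) (hk : 2 ≤ k) (α : ℝ) (hα : α ∈ Set.Ioo (0 : ℝ) 1)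
    (U : Set (Pt n)) (hU : IsOpen U)
    (c : Pt n → ℝ) (hc : ∀ x ∈ U, 0 < c x) (hcr : CHolderOn k α U c)
    (g : Met n) (hg : ∀ x ∈ U, g x = c x • (1 : Matrix (Fin n) (Fin n) ℝ)) :
    (∀ x ∈ U, 0 < c x ^ ((2 - (n : ℝ)) / 4)) ∧
    (∀ x ∈ U, confLap g (fun y => c y ^ ((2 - (n : ℝ)) / 4)) x = 0) ∧
    (∀ i : Fin n, ∀ x ∈ U, confLap g (fun y => y i * c y ^ ((2 - (n : ℝ)) / 4)) x = 0) ∧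
    (∀ x ∈ U, ∀ i : Fin n,
      x i = (x i * c x ^ ((2 - (n : ℝ)) / 4)) / (c x ^ ((2 - (n : ℝ)) / 4))) := by
  have hpow {x : Pt n} (hx : x ∈ U) :
      c x ^ ((2 - (n : ℝ)) / 4) = Real.exp ((2 - (n : ℝ)) / 4 * Real.log (c x)) := by
    rw [Real.rpow_def_of_pos (hc x hx), mul_comm]
  have hφ : ContDiffOn ℝ 2 (fun x => Real.log (c x)) U :=
    (hcr.1.of_le (by exact_mod_cast hk)).log fun x hx => (hc x hx).ne'
  have hg' : ∀ x ∈ U, g x = Real.exp (Real.log (c x)) • (1 : Matrix (Fin n) (Fin n) ℝ) :=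
    fun x hx => by rw [hg x hx, Real.exp_log (hc x hx)]
  have hpos : ∀ x ∈ U, 0 < c x ^ ((2 - (n : ℝ)) / 4) := fun x hx => Real.rpow_pos_of_pos (hc x hx) _
  refine ⟨hpos, fun x hx => ?_, fun i x hx => ?_, fun x hx i => ?_⟩
  · exact confLap_conformallyFlat_eq_zero (by omega) hU hφ hg' (differentiable_const (1 : ℝ))
      (fun _ _ => pd_const _) (fun y hy => by rw [one_mul, hpow hy]) hx
  · exact confLap_conformallyFlat_eq_zero (by omega) hU hφ hg' (differentiable_apply i)
      (fun _ _ => pd_coord i) (fun y hy => by rw [hpow hy]) hx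
  · rw [mul_div_cancel_right₀ _ (hpos x hx).ne']
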